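/- If W is an n_x n_y × n_x n_y Hermitian matrix such that (x⊗y)†W(x⊗y) > 0 for all unit vectors x ∈ ℂ^{n_x}, y ∈ ℂ^{n_y}, then there exists a positive integer r such that the polynomial (x⊗y)†W(x⊗y)·(x†x)^r is a Hermitian sum of squares, i.e., equals (x^{⊗(r+1)}⊗y)† H (x^{⊗(r+1)}⊗y) for some positive semidefinite Hermitian matrix H. -/

import Mathlib

open Matrix
open scoped ComplexOrder

noncomputable section DPSaux
open MeasureTheory MvPolynomial

/-- Gaussian weight on the complex plane. -/
def dpsW (z : ℂ) : ℂ := ((Real.pi⁻¹ * Real.exp (-‖z‖ ^ 2) : ℝ) : ℂ)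

lemma dps_norm_integrable (q : ℕ) :
    Integrable (fun z : ℂ => ‖z‖ ^ q * Real.exp (-‖z‖ ^ 2)) := by
  have h := Complex.integral_rpow_mul_exp_neg_rpow (p := 2) (q := q) (by norm_num)
    (by have : (0:ℝ) ≤ q := by positivity
        linarith)
  by_contra hc
  have h2 : (fun z : ℂ => ‖z‖ ^ (q : ℝ) * Real.exp (-‖z‖ ^ (2:ℝ))) =
      (fun z : ℂ => ‖z‖ ^ q * Real.exp (-‖z‖ ^ 2)) := by
    funext z
    norm_num [Real.rpow_natCast]
  rw [h2, integral_undef hc] at h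
  have : 0 < Real.Gamma (((q:ℝ) + 2) / 2) := Real.Gamma_pos_of_pos (by positivity)
  have hp := Real.pi_pos
  have : 0 < 2 * Real.pi / 2 * Real.Gamma (((q:ℝ) + 2) / 2) := by positivity
  linarith

lemma dps_norm_integral (a : ℕ) :
    ∫ z : ℂ, ‖z‖ ^ (2 * a) * Real.exp (-‖z‖ ^ 2) = Real.pi * a.factorial := by
  have h := Complex.integral_rpow_mul_exp_neg_rpow (p := 2) (q := (2 * a : ℕ)) (by norm_num)
    (by have : (0:ℝ) ≤ (2 * a : ℕ) := by positivity
        linarith)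
  have h2 : (fun z : ℂ => ‖z‖ ^ ((2 * a : ℕ) : ℝ) * Real.exp (-‖z‖ ^ (2:ℝ))) =
      (fun z : ℂ => ‖z‖ ^ (2 * a) * Real.exp (-‖z‖ ^ 2)) := by
    funext z
    rw [Real.rpow_natCast]
    norm_num
  rw [h2] at h
  rw [h]
  have : (((2 * a : ℕ) : ℝ) + 2) / 2 = a + 1 := by push_cast; ring
  rw [this, Real.Gamma_nat_eq_factorial]
  ring

lemma dps_cont (a b : ℕ) : Continuous (fun z : ℂ => z ^ a * (star z) ^ b * dpsW z) := by
  unfold dpsW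
  fun_prop

lemma dps_mom_integrable (a b : ℕ) :
    Integrable (fun z : ℂ => z ^ a * (star z) ^ b * dpsW z) := by
  refine ((dps_norm_integrable (a + b)).const_mul Real.pi⁻¹).mono'
    (dps_cont a b).aestronglyMeasurable (Filter.Eventually.of_forall fun z => ?_)
  have hp := Real.pi_pos
  have : ‖dpsW z‖ = Real.pi⁻¹ * Real.exp (-‖z‖ ^ 2) := by
    unfold dpsW
    rw [Complex.norm_real, Real.norm_eq_abs, abs_of_nonneg (by positivity)]
  rw [norm_mul, norm_mul, norm_pow, norm_pow, norm_star, this]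
  apply le_of_eq
  ring

/-- The moments. -/
def dpsM (a b : ℕ) : ℂ := if a = b then (a.factorial : ℂ) else 0

lemma dps_mom (a b : ℕ) : ∫ z : ℂ, z ^ a * (star z) ^ b * dpsW z = dpsM a b := by
  unfold dpsM
  split_ifs with hab
  · subst hab
    have : (fun z : ℂ => z ^ a * (star z) ^ a * dpsW z) =
        fun z : ℂ => ((Real.pi⁻¹ * (‖z‖ ^ (2 * a) * Real.exp (-‖z‖ ^ 2)) : ℝ) : ℂ) := by
      funext z
      unfold dpsW
      rw [← mul_pow]
      have : z * star z = ((‖z‖ ^ 2 : ℝ) : ℂ) := by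
        have := Complex.mul_conj z
        rw [Complex.normSq_eq_norm_sq] at this
        exact this
      rw [this]
      push_cast
      ring
    rw [this, integral_complex_ofReal, integral_const_mul, dps_norm_integral]
    have := Real.pi_ne_zero
    field_simp
    simp
  · set I := ∫ z : ℂ, z ^ a * (star z) ^ b * dpsW z with hI
    -- rotation by `exp (i θ)`
    have key : ∀ θ : ℝ, Complex.exp (((a : ℝ) - b) * θ * Complex.I) * I = I := by
      intro θ
      have h1 := (rotation (Circle.exp θ)).measurePreserving.integral_comp'
        (f := (rotation (Circle.exp θ)).toHomeomorph.toMeasurableEquiv)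
        (fun z : ℂ => z ^ a * (star z) ^ b * dpsW z)
      rw [← hI] at h1
      refine Eq.trans ?_ h1
      rw [hI, ← integral_const_mul]
      congr 1
      funext z
      change _ = (rotation (Circle.exp θ) z) ^ a * (star (rotation (Circle.exp θ) z)) ^ b *
        dpsW (rotation (Circle.exp θ) z)
      have hw : dpsW (rotation (Circle.exp θ) z) = dpsW z := by
        unfold dpsW
        rw [LinearIsometryEquiv.norm_map]
      rw [hw, rotation_apply, star_mul', mul_pow, mul_pow, Circle.coe_exp]
      have : star (Complex.exp (θ * Complex.I)) = Complex.exp (-(θ * Complex.I)) := by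
        change (starRingEnd ℂ) _ = _
        rw [← Complex.exp_conj]
        simp
      rw [this, ← Complex.exp_nat_mul, ← Complex.exp_nat_mul]
      have : Complex.exp (((a : ℝ) - b) * θ * Complex.I) =
        Complex.exp (a * (θ * Complex.I)) * Complex.exp (b * -(θ * Complex.I)) := by
        rw [← Complex.exp_add]
        congr 1
        push_cast
        ring
      rw [this]
      ring
    have hne : (a : ℝ) - b ≠ 0 := by
      rw [sub_ne_zero]
      exact_mod_cast hab
    have h := key (Real.pi / ((a : ℝ) - b))
    have h3 : (((a : ℝ) : ℂ) - b) * ((Real.pi / ((a : ℝ) - b) : ℝ) : ℂ) * Complex.I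
        = Real.pi * Complex.I := by
      have : (((a : ℝ) : ℂ) - b) ≠ 0 := by exact_mod_cast hne
      push_cast at this ⊢
      field_simp
    rw [h3, Complex.exp_pi_mul_I] at h
    linear_combination (-1/2) * h

variable {n : ℕ}

/-- evaluation point (u, conj u) -/
def dpsPt (u : Fin n → ℂ) : Fin n ⊕ Fin n → ℂ := Sum.elim u (star u)

/-- integrand -/
def dpsF (p : MvPolynomial (Fin n ⊕ Fin n) ℂ) (u : Fin n → ℂ) : ℂ :=
  eval (dpsPt u) p * ∏ i, dpsW (u i)

lemma dpsF_monomial (m : Fin n ⊕ Fin n →₀ ℕ) (c : ℂ) (u : Fin n → ℂ) :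
    dpsF (monomial m c) u =
      c * ∏ i, ((u i) ^ (m (.inl i)) * (star (u i)) ^ (m (.inr i)) * dpsW (u i)) := by
  unfold dpsF
  rw [eval_monomial, Finsupp.prod_fintype _ _ (by simp), Fintype.prod_sum_type]
  simp only [dpsPt, Sum.elim_inl, Sum.elim_inr, Pi.star_apply, Finset.prod_mul_distrib]
  ring

lemma dpsF_integrable (p : MvPolynomial (Fin n ⊕ Fin n) ℂ) : Integrable (dpsF p) := by
  induction p using MvPolynomial.induction_on' with
  | monomial m c =>
    rw [funext (dpsF_monomial m c)]
    exact (Integrable.fintype_prod (f := fun i (z : ℂ) =>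
      z ^ (m (.inl i)) * (star z) ^ (m (.inr i)) * dpsW z)
      (fun i => dps_mom_integrable _ _)).const_mul c
  | add p q hp hq =>
    have : dpsF (p + q) = fun u => dpsF p u + dpsF q u := by
      funext u; simp [dpsF, add_mul]
    rw [this]
    exact hp.add hq

/-- The Gaussian expectation functional. -/
def dpsL : MvPolynomial (Fin n ⊕ Fin n) ℂ →ₗ[ℂ] ℂ where
  toFun p := ∫ u, dpsF p u
  map_add' p q := by
    rw [← integral_add (dpsF_integrable p) (dpsF_integrable q)]
    congr 1
    funext u; simp [dpsF, add_mul]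
  map_smul' c p := by
    simp only [smul_eq_mul, RingHom.id_apply]
    rw [← integral_const_mul]
    congr 1
    funext u; simp [dpsF, mul_assoc]

lemma dpsL_monomial (m : Fin n ⊕ Fin n →₀ ℕ) (c : ℂ) :
    dpsL (monomial m c) = c * ∏ i, dpsM (m (.inl i)) (m (.inr i)) := by
  change ∫ u, dpsF _ u = _
  rw [funext (dpsF_monomial m c), integral_const_mul,
    integral_fintype_prod_volume_eq_prod (f := fun i (z : ℂ) =>
      z ^ (m (.inl i)) * (star z) ^ (m (.inr i)) * dpsW z)]
  simp only [dps_mom]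

lemma dpsL_one : dpsL (1 : MvPolynomial (Fin n ⊕ Fin n) ℂ) = 1 := by
  have := dpsL_monomial (n := n) 0 1
  simpa [dpsM] using this

lemma dpsL_X (j : Fin n) (p : MvPolynomial (Fin n ⊕ Fin n) ℂ) :
    dpsL (X (.inl j) * p) = dpsL (pderiv (.inr j) p) := by
  induction p using MvPolynomial.induction_on' with
  | add p q hp hq => rw [mul_add, map_add, hp, hq, map_add, map_add]
  | monomial m c =>
    have : X (.inl j) * monomial m c = monomial (Finsupp.single (.inl j) 1 + m) c := by
      rw [monomial_single_add, pow_one]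
    rw [this, pderiv_monomial, dpsL_monomial, dpsL_monomial, mul_assoc]
    congr 1
    rw [← Finset.mul_prod_erase _ _ (Finset.mem_univ j),
      ← Finset.mul_prod_erase Finset.univ
        (fun i => dpsM ((m - Finsupp.single (Sum.inr j) 1 : Fin n ⊕ Fin n →₀ ℕ) (Sum.inl i))
          ((m - Finsupp.single (Sum.inr j) 1 : Fin n ⊕ Fin n →₀ ℕ) (Sum.inr i))) (Finset.mem_univ j), ← mul_assoc]
    congr 1
    · simp [dpsM]
      rcases h : m (.inr j) with _ | b
      · simp
      · simp only [add_comm 1, Nat.add_right_cancel_iff, Nat.add_sub_cancel]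
        split_ifs with hh
        · rw [hh, Nat.factorial_succ]; push_cast; ring
        · simp
    · refine Finset.prod_congr rfl fun i hi => ?_
      have := (Finset.ne_of_mem_erase hi).symm
      simp [this]

lemma dpsL_Y (j : Fin n) (p : MvPolynomial (Fin n ⊕ Fin n) ℂ) :
    dpsL (X (.inr j) * p) = dpsL (pderiv (.inl j) p) := by
  induction p using MvPolynomial.induction_on' with
  | add p q hp hq => rw [mul_add, map_add, hp, hq, map_add, map_add]
  | monomial m c =>
    have : X (.inr j) * monomial m c = monomial (Finsupp.single (.inr j) 1 + m) c := by
      rw [monomial_single_add, pow_one]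
    rw [this, pderiv_monomial, dpsL_monomial, dpsL_monomial, mul_assoc]
    congr 1
    rw [← Finset.mul_prod_erase _ _ (Finset.mem_univ j),
      ← Finset.mul_prod_erase Finset.univ
        (fun i => dpsM ((m - Finsupp.single (Sum.inl j) 1 : Fin n ⊕ Fin n →₀ ℕ) (Sum.inl i))
          ((m - Finsupp.single (Sum.inl j) 1 : Fin n ⊕ Fin n →₀ ℕ) (Sum.inr i))) (Finset.mem_univ j), ← mul_assoc]
    congr 1
    · simp [dpsM]
      rcases h : m (.inl j) with _ | b
      · simp
        omega
      · simp only [add_comm 1, Nat.add_right_cancel_iff, Nat.add_sub_cancel]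
        split_ifs with hh
        · rw [Nat.factorial_succ]; push_cast; ring
        · simp
    · refine Finset.prod_congr rfl fun i hi => ?_
      have := (Finset.ne_of_mem_erase hi).symm
      simp [this]

lemma dpsW_prod (u : Fin n → ℂ) : ∃ t : ℝ, 0 ≤ t ∧ ∏ i, dpsW (u i) = (t : ℂ) := by
  have hp := Real.pi_pos
  refine ⟨∏ i, (Real.pi⁻¹ * Real.exp (-‖u i‖ ^ 2)), Finset.prod_nonneg fun i _ => by positivity, ?_⟩
  simp [dpsW]

lemma dpsL_nonneg (p : MvPolynomial (Fin n ⊕ Fin n) ℂ)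
    (h : ∀ u : Fin n → ℂ, 0 ≤ eval (dpsPt u) p) : 0 ≤ dpsL p := by
  change 0 ≤ ∫ u, dpsF p u
  refine integral_nonneg fun u => ?_
  obtain ⟨t, ht, h2⟩ := dpsW_prod u
  change 0 ≤ eval (dpsPt u) p * _
  rw [h2]
  exact mul_nonneg (h u) (by exact_mod_cast ht)

lemma dpsL_star (p q : MvPolynomial (Fin n ⊕ Fin n) ℂ)
    (h : ∀ u : Fin n → ℂ, eval (dpsPt u) q = star (eval (dpsPt u) p)) :
    dpsL q = star (dpsL p) := by
  change ∫ u, dpsF q u = (starRingEnd ℂ) (∫ u, dpsF p u)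
  rw [← integral_conj]
  congr 1
  funext u
  obtain ⟨t, ht, h2⟩ := dpsW_prod u
  simp only [dpsF, h2, h u, map_mul, Complex.conj_ofReal]
  rfl


/-- linear form in u -/
def dpsA (c : Fin n → ℂ) : MvPolynomial (Fin n ⊕ Fin n) ℂ := ∑ l, C (c l) * X (.inl l)
/-- linear form in conj u -/
def dpsB (d : Fin n → ℂ) : MvPolynomial (Fin n ⊕ Fin n) ℂ := ∑ l, C (d l) * X (.inr l)

lemma dpsA_inr (c : Fin n → ℂ) (j : Fin n) : pderiv (.inr j) (dpsA c) = 0 := by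
  simp [dpsA, pderiv_X]

lemma dpsB_inl (c : Fin n → ℂ) (j : Fin n) : pderiv (.inl j) (dpsB c) = 0 := by
  simp [dpsB, pderiv_X]

lemma dpsA_inl (c : Fin n → ℂ) (j : Fin n) : pderiv (.inl j) (dpsA c) = C (c j) := by
  simp [dpsA, pderiv_X, Pi.single_apply]

lemma dpsB_inr (c : Fin n → ℂ) (j : Fin n) : pderiv (.inr j) (dpsB c) = C (c j) := by
  simp [dpsB, pderiv_X, Pi.single_apply]

lemma dpsL_C_mul (c : ℂ) (p : MvPolynomial (Fin n ⊕ Fin n) ℂ) : dpsL (C c * p) = c * dpsL p := by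
  rw [← smul_eq_C_mul, map_smul, smul_eq_mul]

lemma dps_step1 (c d : Fin n → ℂ) (k : ℕ) (j : Fin n) :
    dpsL (X (.inl j) * (dpsA c ^ k * dpsB d ^ (k + 1))) =
      (k + 1) * d j * dpsL (dpsA c ^ k * dpsB d ^ k) := by
  rw [dpsL_X, ← dpsL_C_mul]
  congr 1
  simp only [Derivation.leibniz, Derivation.leibniz_pow, dpsA_inr, dpsB_inr, smul_eq_mul,
    nsmul_eq_mul, map_mul, map_add, map_one, map_natCast]
  simp
  ring

lemma dps_step2 (c d : Fin n → ℂ) (k : ℕ) (j : Fin n) :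
    dpsL (X (.inr j) * (dpsA c ^ (k + 1) * dpsB d ^ k)) =
      (k + 1) * c j * dpsL (dpsA c ^ k * dpsB d ^ k) := by
  rw [dpsL_Y, ← dpsL_C_mul]
  congr 1
  simp only [Derivation.leibniz, Derivation.leibniz_pow, dpsA_inl, dpsB_inl, smul_eq_mul,
    nsmul_eq_mul, map_mul, map_add, map_one, map_natCast]
  simp
  ring

lemma dps_AB (c d : Fin n → ℂ) (k : ℕ) :
    dpsL (dpsA c ^ k * dpsB d ^ k) = k.factorial * (∑ l, c l * d l) ^ k := by
  induction k with
  | zero => simp [dpsL_one]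
  | succ k ih =>
    have : dpsA c ^ (k + 1) * dpsB d ^ (k + 1) =
        ∑ l, C (c l) * (X (.inl l) * (dpsA c ^ k * dpsB d ^ (k + 1))) := by
      rw [pow_succ (dpsA c), mul_comm (dpsA c ^ k), mul_assoc]
      conv_lhs => rw [dpsA, Finset.sum_mul]
      refine Finset.sum_congr rfl fun l _ => ?_
      rw [mul_assoc, dpsA]
    rw [this, map_sum]
    simp only [dpsL_C_mul, dps_step1, ih]
    rw [Nat.factorial_succ, pow_succ (∑ l, c l * d l), Finset.mul_sum, Finset.mul_sum]
    refine Finset.sum_congr rfl fun l _ => ?_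
    push_cast
    ring

lemma dps_key (c d : Fin n → ℂ) (k : ℕ) (i j : Fin n) :
    dpsL (X (.inr i) * X (.inl j) * (dpsA c ^ (k + 1) * dpsB d ^ (k + 1))) =
      (k + 1).factorial * ((if i = j then 1 else 0) * (∑ l, c l * d l) ^ (k + 1) +
        (k + 1) * (c i * d j) * (∑ l, c l * d l) ^ k) := by
  have h1 : X (.inr i) * X (.inl j) * (dpsA c ^ (k + 1) * dpsB d ^ (k + 1)) =
      X (.inl j) * (X (.inr i) * (dpsA c ^ (k + 1) * dpsB d ^ (k + 1))) := by ring
  have h2 : pderiv (.inr j) (X (.inr i) * (dpsA c ^ (k + 1) * dpsB d ^ (k + 1))) =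
      C (if i = j then 1 else 0) * (dpsA c ^ (k + 1) * dpsB d ^ (k + 1)) +
      C ((k + 1) * d j) * (X (.inr i) * (dpsA c ^ (k + 1) * dpsB d ^ k)) := by
    simp only [Derivation.leibniz, Derivation.leibniz_pow, dpsA_inr, dpsB_inr, smul_eq_mul,
      nsmul_eq_mul, map_mul, map_add, map_one, map_natCast, pderiv_X, Pi.single_apply]
    split_ifs with h h' h' <;> simp_all
    all_goals ring
  rw [h1, dpsL_X, h2, map_add, dpsL_C_mul, dpsL_C_mul, dps_step2, dps_AB, dps_AB,
    Nat.factorial_succ]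
  push_cast
  ring

lemma dps_rearr {R : Type*} [CommRing R] {F K : Type*} [Fintype F] [Fintype K]
    (α β : F × K → R) (G : K → K → R) (U V : F → R) :
    ∑ p, ∑ q, α p * β q * (G p.2 q.2 * (U p.1 * V q.1)) =
      ∑ a, ∑ b, G a b * ((∑ f, α (f, a) * U f) * (∑ g, β (g, b) * V g)) := by
  simp only [Fintype.sum_prod_type, Finset.sum_mul_sum]
  simp only [Finset.mul_sum]
  rw [Finset.sum_comm]
  refine Finset.sum_congr rfl fun a _ => ?_
  conv_rhs => rw [Finset.sum_comm]
  refine Finset.sum_congr rfl fun f _ => ?_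
  rw [Finset.sum_comm]
  refine Finset.sum_congr rfl fun b _ => ?_
  refine Finset.sum_congr rfl fun g _ => ?_
  ring

variable {ny : ℕ}

/-- matrix-valued form in u -/
def dpsG (Q : Matrix (Fin n × Fin ny) (Fin n × Fin ny) ℂ) (a b : Fin ny) :
    MvPolynomial (Fin n ⊕ Fin n) ℂ :=
  ∑ i, ∑ j, C (Q (i, a) (j, b)) * (X (.inr i) * X (.inl j))

/-- entries before taking expectation -/
def dpsh (Q : Matrix (Fin n × Fin ny) (Fin n × Fin ny) ℂ) (k : ℕ)
    (p q : (Fin k → Fin n) × Fin ny) : MvPolynomial (Fin n ⊕ Fin n) ℂ :=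
  dpsG Q p.2 q.2 * ((∏ s, X (.inl (p.1 s))) * (∏ s, X (.inr (q.1 s))))

/-- the matrix H -/
def dpsH (Q : Matrix (Fin n × Fin ny) (Fin n × Fin ny) ℂ) (k : ℕ) :
    Matrix ((Fin k → Fin n) × Fin ny) ((Fin k → Fin n) × Fin ny) ℂ :=
  Matrix.of fun p q => dpsL (dpsh Q k p q)

lemma dps_form (Q : Matrix (Fin n × Fin ny) (Fin n × Fin ny) ℂ) (x : Fin n → ℂ) (y : Fin ny → ℂ) :
    (star (fun p : Fin n × Fin ny => x p.1 * y p.2) ⬝ᵥ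
            Q *ᵥ (fun p : Fin n × Fin ny => x p.1 * y p.2)) =
    ∑ a, ∑ b, (∑ i, ∑ j, Q (i, a) (j, b) * (star (x i) * x j)) * (star (y a) * y b) := by
  simp only [dotProduct, mulVec, Fintype.sum_prod_type, Finset.mul_sum, Finset.sum_mul]
  rw [Finset.sum_comm]
  refine Finset.sum_congr rfl fun a _ => ?_
  conv_rhs => rw [Finset.sum_comm]
  refine Finset.sum_congr rfl fun i _ => ?_
  rw [Finset.sum_comm]
  refine Finset.sum_congr rfl fun b _ => ?_
  refine Finset.sum_congr rfl fun j _ => ?_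
  simp
  ring

lemma dpsH_quad (Q : Matrix (Fin n × Fin ny) (Fin n × Fin ny) ℂ) (k : ℕ)
    (w : (Fin k → Fin n) × Fin ny → ℂ) :
    star w ⬝ᵥ dpsH Q k *ᵥ w = dpsL (∑ p, ∑ q, C (star (w p)) * C (w q) * dpsh Q k p q) := by
  simp only [dotProduct, mulVec, dpsH, map_sum, ← C_mul, dpsL_C_mul, Finset.mul_sum,
    Matrix.of_apply, Pi.star_apply]
  refine Finset.sum_congr rfl fun p _ => Finset.sum_congr rfl fun q _ => ?_
  ring

lemma dpsG_eval (Q : Matrix (Fin n × Fin ny) (Fin n × Fin ny) ℂ) (a b : Fin ny) (u : Fin n → ℂ) :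
    eval (dpsPt u) (dpsG Q a b) = ∑ i, ∑ j, Q (i, a) (j, b) * (star (u i) * u j) := by
  simp [dpsG, dpsPt]

lemma dpsH_posSemidef (Q : Matrix (Fin n × Fin ny) (Fin n × Fin ny) ℂ) (k : ℕ)
    (hQ : Q.IsHermitian)
    (hpos : ∀ (x : Fin n → ℂ) (y : Fin ny → ℂ),
      0 ≤ (star (fun p : Fin n × Fin ny => x p.1 * y p.2) ⬝ᵥ
            Q *ᵥ (fun p : Fin n × Fin ny => x p.1 * y p.2))) : (dpsH Q k).PosSemidef := by
  refine Matrix.PosSemidef.of_dotProduct_mulVec_nonneg ?_ fun w => ?_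
  · ext p q
    rw [conjTranspose_apply]
    refine (dpsL_star _ _ fun u => ?_).symm
    simp only [dpsh, map_mul, dpsG_eval, star_mul', star_sum, map_prod, eval_X]
    have e1 : ∀ i, dpsPt u (.inl i) = u i := fun i => rfl
    have e2 : ∀ i, dpsPt u (.inr i) = star (u i) := fun i => rfl
    simp only [e1, e2, star_prod, star_star]
    congr 1
    · rw [Finset.sum_comm]
      refine Finset.sum_congr rfl fun i _ => Finset.sum_congr rfl fun j _ => ?_
      rw [hQ.apply]
      ring
    · ring
  · rw [dpsH_quad]
    refine dpsL_nonneg _ fun u => ?_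
    have := hpos u (fun b => ∑ g : Fin k → Fin n, w (g, b) * ∏ s, star (u (g s)))
    rw [dps_form Q u (fun b => ∑ g : Fin k → Fin n, w (g, b) * ∏ s, star (u (g s)))] at this
    convert this using 1
    simp only [map_sum, map_mul, dpsh, eval_C, dpsG_eval, map_prod, eval_X]
    rw [dps_rearr (fun p => star (w p)) w
      (fun a b => ∑ i, ∑ j, Q (i, a) (j, b) * (star (u i) * u j))
      (fun f : Fin k → Fin n => ∏ s, dpsPt u (.inl (f s)))
      (fun f : Fin k → Fin n => ∏ s, dpsPt u (.inr (f s)))]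
    refine Finset.sum_congr rfl fun a _ => Finset.sum_congr rfl fun b _ => ?_
    simp [dpsPt]

lemma dpsH_prod (Q : Matrix (Fin n × Fin ny) (Fin n × Fin ny) ℂ) (r : ℕ)
    (x : Fin n → ℂ) (y : Fin ny → ℂ) :
    star (fun p : (Fin (r + 1) → Fin n) × Fin ny => (∏ i, x (p.1 i)) * y p.2) ⬝ᵥ
      dpsH Q (r + 1) *ᵥ (fun p : (Fin (r + 1) → Fin n) × Fin ny => (∏ i, x (p.1 i)) * y p.2) =
    (r + 1).factorial * ((star x ⬝ᵥ x) ^ (r + 1) *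
        (∑ a, ∑ b, (∑ i, Q (i, a) (i, b)) * (star (y a) * y b)) +
      (r + 1) * (star x ⬝ᵥ x) ^ r * (star (fun p : Fin n × Fin ny => x p.1 * y p.2) ⬝ᵥ
            Q *ᵥ (fun p : Fin n × Fin ny => x p.1 * y p.2))) := by
  rw [dpsH_quad]
  unfold dpsh
  rw [dps_rearr (fun p : (Fin (r + 1) → Fin n) × Fin ny =>
      (C (star ((∏ i, x (p.1 i)) * y p.2)) : MvPolynomial (Fin n ⊕ Fin n) ℂ))
      (fun p => C ((∏ i, x (p.1 i)) * y p.2)) (dpsG Q)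
      (fun f : Fin (r + 1) → Fin n => ∏ s, X (.inl (f s)))
      (fun f : Fin (r + 1) → Fin n => ∏ s, X (.inr (f s)))]
  have hA : ∀ a, ∑ f : Fin (r + 1) → Fin n, (C (star ((∏ i, x (f i)) * y a)) :
      MvPolynomial (Fin n ⊕ Fin n) ℂ) * ∏ s, X (.inl (f s)) =
      C (star (y a)) * dpsA (star x) ^ (r + 1) := by
    intro a
    rw [dpsA, Fintype.sum_pow, Finset.mul_sum]
    refine Finset.sum_congr rfl fun f _ => ?_
    rw [Finset.prod_mul_distrib, star_mul', star_prod, C_mul, map_prod]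
    simp only [Pi.star_apply]
    ring
  have hB : ∀ a, ∑ f : Fin (r + 1) → Fin n, (C ((∏ i, x (f i)) * y a) :
      MvPolynomial (Fin n ⊕ Fin n) ℂ) * ∏ s, X (.inr (f s)) =
      C (y a) * dpsB x ^ (r + 1) := by
    intro a
    rw [dpsB, Fintype.sum_pow, Finset.mul_sum]
    refine Finset.sum_congr rfl fun f _ => ?_
    rw [Finset.prod_mul_distrib, C_mul, map_prod]
    ring
  have hs : ∑ l, (star x) l * x l = star x ⬝ᵥ x := rfl
  simp only [hA, hB, dps_form, map_sum]
  have hG : ∀ a b, dpsL (dpsG Q a b * ((C (star (y a)) * dpsA (star x) ^ (r + 1)) *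
      (C (y b) * dpsB x ^ (r + 1)))) = star (y a) * y b * ∑ i, ∑ j, Q (i, a) (j, b) *
        ((r + 1).factorial * ((if i = j then 1 else 0) * (star x ⬝ᵥ x) ^ (r + 1) +
        (r + 1) * (star (x i) * x j) * (star x ⬝ᵥ x) ^ r)) := by
    intro a b
    have : dpsG Q a b * ((C (star (y a)) * dpsA (star x) ^ (r + 1)) *
      (C (y b) * dpsB x ^ (r + 1))) = C (star (y a) * y b) * ∑ i, ∑ j, C (Q (i, a) (j, b)) *
        (X (.inr i) * X (.inl j) * (dpsA (star x) ^ (r + 1) * dpsB x ^ (r + 1))) := by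
      simp only [dpsG, C_mul, Finset.sum_mul, Finset.mul_sum]
      refine Finset.sum_congr rfl fun i _ => Finset.sum_congr rfl fun j _ => ?_
      ring
    rw [this, dpsL_C_mul]
    simp only [map_sum, dpsL_C_mul, dps_key, hs]
    rfl
  simp only [hG]
  rw [Finset.mul_sum, Finset.mul_sum, ← Finset.sum_add_distrib, Finset.mul_sum]
  refine Finset.sum_congr rfl fun a _ => ?_
  rw [Finset.mul_sum, Finset.mul_sum, ← Finset.sum_add_distrib, Finset.mul_sum]
  refine Finset.sum_congr rfl fun b _ => ?_
  have h1 : ∑ i, Q (i, a) (i, b) = ∑ i, ∑ j, Q (i, a) (j, b) * (if i = j then 1 else 0) := by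
    simp
  rw [h1]
  simp only [Finset.mul_sum, Finset.sum_mul, ← Finset.sum_add_distrib]
  refine Finset.sum_congr rfl fun i _ => Finset.sum_congr rfl fun j _ => ?_
  ring


/-- the partial trace form -/
def dpsTau (W : Matrix (Fin n × Fin ny) (Fin n × Fin ny) ℂ) (y : Fin ny → ℂ) : ℂ :=
  ∑ a, ∑ b, (∑ i, W (i, a) (i, b)) * (star (y a) * y b)

/-- the product form -/
def dpsP (W : Matrix (Fin n × Fin ny) (Fin n × Fin ny) ℂ) (x : Fin n → ℂ) (y : Fin ny → ℂ) : ℂ :=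
  ∑ a, ∑ b, (∑ i, ∑ j, W (i, a) (j, b) * (star (x i) * x j)) * (star (y a) * y b)

/-- the corrected matrix -/
def dpsQ (W : Matrix (Fin n × Fin ny) (Fin n × Fin ny) ℂ) (β : ℝ) :
    Matrix (Fin n × Fin ny) (Fin n × Fin ny) ℂ :=
  Matrix.of fun p q => W p q - β * (if p.1 = q.1 then ∑ i, W (i, p.2) (i, q.2) else 0)

lemma dpsQ_herm (W : Matrix (Fin n × Fin ny) (Fin n × Fin ny) ℂ) (hW : W.IsHermitian) (β : ℝ) :
    (dpsQ W β).IsHermitian := by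
  ext p q
  rw [conjTranspose_apply]
  simp only [dpsQ, Matrix.of_apply, star_sub, hW.apply, star_mul']
  have : star (β : ℂ) = β := Complex.conj_ofReal β
  rw [this]
  by_cases h : p.1 = q.1
  · rw [if_pos h, if_pos h.symm, star_sum]
    simp only [hW.apply]
  · rw [if_neg h, if_neg (Ne.symm h), star_zero]

lemma dpsQ_P (W : Matrix (Fin n × Fin ny) (Fin n × Fin ny) ℂ) (β : ℝ)
    (x : Fin n → ℂ) (y : Fin ny → ℂ) :
    dpsP (dpsQ W β) x y = dpsP W x y - β * (star x ⬝ᵥ x) * dpsTau W y := by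
  unfold dpsP dpsTau
  rw [Finset.mul_sum, ← Finset.sum_sub_distrib]
  refine Finset.sum_congr rfl fun a _ => ?_
  rw [Finset.mul_sum, ← Finset.sum_sub_distrib]
  refine Finset.sum_congr rfl fun b _ => ?_
  have : ∑ i, ∑ j, dpsQ W β (i, a) (j, b) * (star (x i) * x j) =
      ∑ i, ∑ j, W (i, a) (j, b) * (star (x i) * x j) -
        β * (∑ l, W (l, a) (l, b)) * (star x ⬝ᵥ x) := by
    rw [dotProduct, Finset.mul_sum, ← Finset.sum_sub_distrib]
    refine Finset.sum_congr rfl fun i _ => ?_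
    simp [dpsQ, sub_mul, Finset.sum_sub_distrib]
  rw [this]
  ring

lemma dpsQ_tr (W : Matrix (Fin n × Fin ny) (Fin n × Fin ny) ℂ) (β : ℝ) (y : Fin ny → ℂ) :
    dpsTau (dpsQ W β) y = (1 - n * β) * dpsTau W y := by
  unfold dpsTau
  rw [Finset.mul_sum]
  refine Finset.sum_congr rfl fun a _ => ?_
  rw [Finset.mul_sum]
  refine Finset.sum_congr rfl fun b _ => ?_
  have : ∑ i, dpsQ W β (i, a) (i, b) = (1 - n * β) * ∑ i, W (i, a) (i, b) := by
    simp [dpsQ, Finset.sum_sub_distrib]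
    ring
  rw [this]
  ring

lemma dpsP_smul (W : Matrix (Fin n × Fin ny) (Fin n × Fin ny) ℂ) (c d : ℝ)
    (x : Fin n → ℂ) (y : Fin ny → ℂ) :
    dpsP W (fun i => c * x i) (fun i => d * y i) = ((c ^ 2 * d ^ 2 : ℝ) : ℂ) * dpsP W x y := by
  unfold dpsP
  have hc : star (c : ℂ) = c := Complex.conj_ofReal c
  have hd : star (d : ℂ) = d := Complex.conj_ofReal d
  simp only [Finset.mul_sum, Finset.sum_mul, star_mul', hc, hd]
  refine Finset.sum_congr rfl fun a _ => Finset.sum_congr rfl fun b _ =>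
    Finset.sum_congr rfl fun i _ => Finset.sum_congr rfl fun j _ => ?_
  push_cast
  ring

lemma dps_sq {m : ℕ} (x : Fin m → ℂ) : star x ⬝ᵥ x = ((∑ i, ‖x i‖ ^ 2 : ℝ) : ℂ) := by
  rw [dotProduct]
  push_cast
  refine Finset.sum_congr rfl fun i _ => ?_
  exact Complex.conj_mul' (x i)

lemma dps_normalize {m : ℕ} (x : Fin m → ℂ) :
    x = 0 ∨ ∃ (c : ℝ) (z : Fin m → ℂ), star z ⬝ᵥ z = 1 ∧ x = fun i => (c : ℂ) * z i := by
  by_cases h : x = 0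
  · exact Or.inl h
  right
  set S : ℝ := ∑ i, ‖x i‖ ^ 2 with hS
  have hpos : 0 < S := by
    obtain ⟨i, hi⟩ := Function.ne_iff.mp h
    refine Finset.sum_pos' (fun i _ => by positivity) ⟨i, Finset.mem_univ i, ?_⟩
    have : 0 < ‖x i‖ := norm_pos_iff.mpr hi
    positivity
  have hs := Real.sqrt_pos.mpr hpos
  refine ⟨Real.sqrt S, fun i => ((Real.sqrt S)⁻¹ : ℝ) * x i, ?_, ?_⟩
  · rw [dps_sq]
    simp only [norm_mul, mul_pow, ← Finset.mul_sum, ← hS, Complex.norm_real, Real.norm_eq_abs,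
      sq_abs]
    rw [inv_pow, Real.sq_sqrt hpos.le, inv_mul_cancel₀ hpos.ne']
    simp
  · funext i
    rw [← mul_assoc, ← Complex.ofReal_mul, mul_inv_cancel₀ hs.ne']
    simp

lemma dps_sphere_compact (m : ℕ) : IsCompact {x : Fin m → ℂ | star x ⬝ᵥ x = 1} := by
  refine Metric.isCompact_of_isClosed_isBounded ?_ ?_
  · refine isClosed_eq ?_ continuous_const
    simp only [dotProduct]
    fun_prop
  · refine (Metric.isBounded_closedBall (x := (0 : Fin m → ℂ)) (r := 1)).subset fun x hx => ?_
    rw [mem_closedBall_zero_iff, pi_norm_le_iff_of_nonneg zero_le_one]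
    intro i
    have h : star x ⬝ᵥ x = 1 := hx
    rw [dps_sq] at h
    have h1 : ∑ i, ‖x i‖ ^ 2 = 1 := by exact_mod_cast h
    have h2 := Finset.single_le_sum (f := fun i => ‖x i‖ ^ 2) (fun i _ => by positivity)
      (Finset.mem_univ i)
    simp only [h1] at h2
    nlinarith [norm_nonneg (x i)]

lemma dps_cont_P (W : Matrix (Fin n × Fin ny) (Fin n × Fin ny) ℂ) :
    Continuous fun z : (Fin n → ℂ) × (Fin ny → ℂ) => (dpsP W z.1 z.2).re := by
  unfold dpsP
  fun_prop

lemma dps_cont_tau (W : Matrix (Fin n × Fin ny) (Fin n × Fin ny) ℂ) :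
    Continuous fun z : (Fin n → ℂ) × (Fin ny → ℂ) => (dpsTau W z.2).re := by
  unfold dpsTau
  fun_prop

lemma dps_choose_aux {E : Type*} [TopologicalSpace E] (K : Set E) (hK : IsCompact K)
    (f g : E → ℝ) (hf : Continuous f) (hg : Continuous g) (hpos : ∀ z ∈ K, 0 < f z) :
    ∃ r : ℕ, 0 < r ∧ ∀ z ∈ K, 0 ≤ f z - (1 / ((n : ℝ) + (r + 1))) * g z := by
  rcases K.eq_empty_or_nonempty with he | hne
  · exact ⟨1, one_pos, fun z hz => by simp [he] at hz⟩
  obtain ⟨z, hz, hmin⟩ := hK.exists_isMinOn hne hf.continuousOn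
  obtain ⟨t, ht, hmax⟩ := hK.exists_isMaxOn hne hg.continuousOn
  have hm := hpos z hz
  obtain ⟨r, hr⟩ := exists_nat_gt (g t / f z)
  refine ⟨r + 1, Nat.succ_pos r, fun w hw => ?_⟩
  have h1 : f z ≤ f w := isMinOn_iff.mp hmin w hw
  have h2 : g w ≤ g t := isMaxOn_iff.mp hmax w hw
  rw [div_lt_iff₀ hm] at hr
  have h3 : (0 : ℝ) < (n : ℝ) + (((r + 1 : ℕ) : ℝ) + 1) := by positivity
  rw [one_div, inv_mul_eq_div, sub_nonneg, div_le_iff₀ h3]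
  have h4 : f z * r ≤ f w * (n + (((r + 1 : ℕ) : ℝ) + 1)) := by
    apply mul_le_mul h1 _ (by positivity) (hm.le.trans h1)
    push_cast
    have : (0 : ℝ) ≤ n := by positivity
    linarith
  linarith

lemma dps_choose (W : Matrix (Fin n × Fin ny) (Fin n × Fin ny) ℂ)
    (hpos : ∀ (x : Fin n → ℂ) (y : Fin ny → ℂ),
      star x ⬝ᵥ x = 1 → star y ⬝ᵥ y = 1 → 0 < (dpsP W x y).re) :
    ∃ r : ℕ, 0 < r ∧ ∀ (x : Fin n → ℂ) (y : Fin ny → ℂ),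
      star x ⬝ᵥ x = 1 → star y ⬝ᵥ y = 1 →
      0 ≤ (dpsP W x y).re - (1 / ((n : ℝ) + (r + 1))) * (dpsTau W y).re := by
  obtain ⟨r, hr, h⟩ := dps_choose_aux (n := n)
    ({x : Fin n → ℂ | star x ⬝ᵥ x = 1} ×ˢ {y : Fin ny → ℂ | star y ⬝ᵥ y = 1})
    ((dps_sphere_compact n).prod (dps_sphere_compact ny)) _ _ (dps_cont_P W) (dps_cont_tau W)
    (fun z hz => hpos z.1 z.2 hz.1 hz.2)
  exact ⟨r, hr, fun x y hx hy => h (x, y) (Set.mk_mem_prod hx hy)⟩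

end DPSaux


/-- DPS / Quillen–Catlin–D'Angelo positivstellensatz: if the
Hermitian form (x⊗y)†W(x⊗y) is strictly positive on unit vectors, then for
some positive integer r, (x⊗y)†W(x⊗y)·(x†x)^r is a Hermitian sum of squares,
i.e. equals (x^{⊗(r+1)}⊗y)†H(x^{⊗(r+1)}⊗y) with H PSD (as an identity in
x ∈ ℂ^{n_x}, y ∈ ℂ^{n_y}). -/
theorem dps_positivstellensatz
    {nx ny : ℕ}
    (W : Matrix (Fin nx × Fin ny) (Fin nx × Fin ny) ℂ) (hW : W.IsHermitian)
    (hpos : ∀ (x : Fin nx → ℂ) (y : Fin ny → ℂ),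
      star x ⬝ᵥ x = 1 → star y ⬝ᵥ y = 1 →
      0 < (star (fun p : Fin nx × Fin ny => x p.1 * y p.2) ⬝ᵥ
            W *ᵥ (fun p : Fin nx × Fin ny => x p.1 * y p.2)).re) :
    ∃ r : ℕ, 0 < r ∧
      ∃ H : Matrix ((Fin (r + 1) → Fin nx) × Fin ny)
              ((Fin (r + 1) → Fin nx) × Fin ny) ℂ,
        H.PosSemidef ∧
        ∀ (x : Fin nx → ℂ) (y : Fin ny → ℂ),
          (star (fun p : Fin nx × Fin ny => x p.1 * y p.2) ⬝ᵥ
              W *ᵥ (fun p : Fin nx × Fin ny => x p.1 * y p.2)) *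
            (star x ⬝ᵥ x) ^ r =
          star (fun p : (Fin (r + 1) → Fin nx) × Fin ny =>
              (∏ i, x (p.1 i)) * y p.2) ⬝ᵥ
            H *ᵥ (fun p : (Fin (r + 1) → Fin nx) × Fin ny =>
              (∏ i, x (p.1 i)) * y p.2) := by
  have hpos' : ∀ (x : Fin nx → ℂ) (y : Fin ny → ℂ),
      star x ⬝ᵥ x = 1 → star y ⬝ᵥ y = 1 → 0 < (dpsP W x y).re := by
    intro x y hx hy
    have := hpos x y hx hy
    rwa [dps_form] at this
  obtain ⟨r, hr, hQ⟩ := dps_choose W hpos'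
  set β : ℝ := 1 / ((nx : ℝ) + (r + 1)) with hβ
  have hherm := dpsQ_herm W hW β
  have hnonneg : ∀ (x : Fin nx → ℂ) (y : Fin ny → ℂ),
      0 ≤ (star (fun p : Fin nx × Fin ny => x p.1 * y p.2) ⬝ᵥ
            dpsQ W β *ᵥ (fun p : Fin nx × Fin ny => x p.1 * y p.2)) := by
    intro x y
    rw [Complex.nonneg_iff]
    refine ⟨?_, (hherm.im_star_dotProduct_mulVec_self _).symm⟩
    rw [dps_form]
    change 0 ≤ (dpsP (dpsQ W β) x y).re
    rcases dps_normalize x with rfl | ⟨c, x', hx', rfl⟩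
    · simp [dpsP]
    rcases dps_normalize y with rfl | ⟨d, y', hy', rfl⟩
    · simp [dpsP]
    rw [dpsP_smul, Complex.re_ofReal_mul]
    refine mul_nonneg (by positivity) ?_
    rw [dpsQ_P, hx', mul_one, Complex.sub_re, Complex.re_ofReal_mul]
    exact hQ x' y' hx' hy'
  have hpsd := dpsH_posSemidef (dpsQ W β) (r + 1) hherm hnonneg
  set κ : ℝ := 1 / ((r + 1).factorial * (r + 1)) with hκ
  refine ⟨r, hr, (κ : ℂ) • dpsH (dpsQ W β) (r + 1), hpsd.smul ?_, fun x y => ?_⟩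
  · have : 0 ≤ κ := by positivity
    exact_mod_cast this
  rw [smul_mulVec, dotProduct_smul, dpsH_prod, dps_form, dps_form]
  change dpsP W x y * _ = (κ : ℂ) • (_ * (_ * dpsTau (dpsQ W β) y + _ * dpsP (dpsQ W β) x y))
  rw [dpsQ_P, dpsQ_tr, smul_eq_mul]
  have h1 : ((r + 1).factorial : ℂ) ≠ 0 := by exact_mod_cast (r + 1).factorial_ne_zero
  have h2 : ((r : ℂ) + 1) ≠ 0 := by exact_mod_cast r.succ_ne_zero
  have h3 : (nx : ℂ) + ((r : ℂ) + 1) ≠ 0 := by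
    have : nx + (r + 1) ≠ 0 := by omega
    exact_mod_cast this
  rw [hκ, hβ]
  push_cast
  field_simp
  ring
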